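/- Let Φ = {φ_i}_{i∈I} be a parabolic IFS on [0,1] with D₁(Φ) < ∞. Then Φ has uniform decay of fundamental intervals: lim_{n→∞} sup_{ω ∈ I^n} |J(ω)| = 0, where |·| denotes Euclidean diameter. -/

import Mathlib

open Set MeasureTheory Filter Topology

open scoped ENNReal NNReal Classical

namespace ParabolicIFSPaper

noncomputable section

/-- Composition `φ_{ω₁} ∘ ⋯ ∘ φ_{ω_n}` for a (0-indexed) sequence of digits `ω`. -/
def comp (φ : ℕ → ℝ → ℝ) (ω : ℕ → ℕ) : ℕ → ℝ → ℝ
  | 0 => id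
  | n + 1 => comp φ ω n ∘ φ (ω n)

/-- Composition `φ_{a₁} ∘ ⋯ ∘ φ_{a_n}` along a finite word given as a list. -/
def wcomp (φ : ℕ → ℝ → ℝ) : List ℕ → ℝ → ℝ
  | [] => id
  | a :: l => φ a ∘ wcomp φ l

/-- A parabolic Iterated Function System on `[0,1]`:  an index set `I ⊆ ℕ` with at least two
elements, `C¹` maps `φ i : [0,1] → [0,1]`, the open set condition, the non-uniform contraction
condition (A1) with finitely many parabolic pairs, and the bounded distortion condition (A2). -/
structure PIFS where
  I : Set ℕ
  I_nontrivial : I.Nontrivial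
  φ : ℕ → ℝ → ℝ
  smooth : ∀ i ∈ I, ContDiff ℝ 1 (φ i)
  maps_to : ∀ i ∈ I, MapsTo (φ i) (Icc (0:ℝ) 1) (Icc (0:ℝ) 1)
  osc : ∀ i ∈ I, ∀ j ∈ I, i ≠ j → φ i '' Ioo (0:ℝ) 1 ∩ φ j '' Ioo (0:ℝ) 1 = ∅
  Par : Set ℕ
  Par_sub : Par ⊆ I
  Par_finite : Par.Finite
  fixpt : ℕ → ℝ
  fixpt_mem : ∀ i ∈ Par, fixpt i ∈ Icc (0:ℝ) 1
  fixpt_fixed : ∀ i ∈ Par, φ i (fixpt i) = fixpt i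
  fixpt_unique : ∀ i ∈ Par, ∀ x ∈ Icc (0:ℝ) 1, φ i x = x → x = fixpt i
  deriv_one : ∀ i ∈ Par, |deriv (φ i) (fixpt i)| = 1
  contracting : ∀ i ∈ I, ∀ x ∈ Icc (0:ℝ) 1, (i ∉ Par ∨ x ≠ fixpt i) → |deriv (φ i) x| < 1
  distC : ℝ
  distC_ge_one : 1 ≤ distC
  distortion : ∀ ω : ℕ → ℕ, (∀ k, ω k ∈ I) → ∀ n, 2 ≤ n →
    (ω (n - 1) ∉ Par ∨ ω (n - 2) ≠ ω (n - 1)) →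
    ∀ x ∈ Icc (0:ℝ) 1, ∀ y ∈ Icc (0:ℝ) 1,
      |deriv (comp φ ω n) x| ≤ distC * |deriv (comp φ ω n) y|

/-- The set of admissible digit sequences `I^ℕ`. -/
def PIFS.Seqs (Φ : PIFS) : Set (ℕ → ℕ) := {ω | ∀ k, ω k ∈ Φ.I}

/-- The set of admissible words of length `n`, i.e. `I^n`. -/
def Words (Φ : PIFS) (n : ℕ) : Set (List ℕ) := {l | l.length = n ∧ ∀ a ∈ l, a ∈ Φ.I}

/-- The fundamental interval `J(ω) = φ_ω([0,1])` of a finite word. -/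
def Jset (Φ : PIFS) (l : List ℕ) : Set ℝ := wcomp Φ.φ l '' Icc (0:ℝ) 1

/-- `Pi` is an address map for `Φ` if `Pi ω` lies in every fundamental interval
`φ_{ω₁⋯ω_n}([0,1])`; since these intersections are singletons for a parabolic IFS, this
characterizes the address map. -/
def IsAddressMap (Φ : PIFS) (Pi : (ℕ → ℕ) → ℝ) : Prop :=
  ∀ ω ∈ Φ.Seqs, ∀ n : ℕ, Pi ω ∈ comp Φ.φ ω n '' Icc (0:ℝ) 1

/-- The limit set `Λ(Φ) = Π(I^ℕ)`. -/
def limitSet (Φ : PIFS) (Pi : (ℕ → ℕ) → ℝ) : Set ℝ := Pi '' Φ.Seqs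

/-- The set `Λ_*(Φ)` of points having exactly one address. -/
def uniqueCoded (Φ : PIFS) (Pi : (ℕ → ℕ) → ℝ) : Set ℝ :=
  {x | ∃! ω : ℕ → ℕ, ω ∈ Φ.Seqs ∧ Pi ω = x}

/-- `max{a₁(x),…,a_n(x)} ⋅ (log log n) / n` for the digit sequence `ω`. -/
def ratio (ω : ℕ → ℕ) (n : ℕ) : ℝ :=
  ((((Finset.range n).sup ω : ℕ) : ℝ)) * Real.log (Real.log n) / n

/-- The level set `L(α)` of points whose largest-digit growth rate is `α ∈ [0,∞]`. -/
def levelSet (Φ : PIFS) (Pi : (ℕ → ℕ) → ℝ) (α : EReal) : Set ℝ :=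
  {x ∈ uniqueCoded Φ Pi |
    ∀ ω ∈ Φ.Seqs, Pi ω = x → Tendsto (fun n => (ratio ω n : EReal)) atTop (𝓝 α)}

/-- `Φ` is `d`-decaying: `min_x |φ_i'(x)| ≥ c / i^d`. -/
def Decaying (Φ : PIFS) (d : ℝ) : Prop :=
  ∃ c : ℝ, 0 < c ∧ ∀ i ∈ Φ.I, ∀ x ∈ Icc (0:ℝ) 1, c / (i : ℝ) ^ d ≤ |deriv (Φ.φ i) x|

/-- The shift map on sequence space. -/
def shift : (ℕ → ℕ) → (ℕ → ℕ) := fun ω n => ω (n + 1)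

/-- The Lyapunov exponent `χ(ν) = -∫ log |φ'_{ω₁}(Π ω)| dν(ω)` (in `[0,∞]`). -/
def lyap (Φ : PIFS) (Pi : (ℕ → ℕ) → ℝ) (ν : Measure (ℕ → ℕ)) : ℝ≥0∞ :=
  ∫⁻ ω, ENNReal.ofReal (- Real.log |deriv (Φ.φ (ω 0)) (Pi ω)|) ∂ν

/-- The class `𝓜(Φ)` of shift-invariant ergodic probability measures carried by `I^ℕ`
with finite Lyapunov exponent. -/
def MeasClass (Φ : PIFS) (Pi : (ℕ → ℕ) → ℝ) : Set (Measure (ℕ → ℕ)) :=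
  {ν | IsProbabilityMeasure ν ∧ ν Φ.Seqs = 1 ∧ Ergodic shift ν ∧ lyap Φ Pi ν < ⊤}

/-- `dim(μ) = inf {dim_H A : A ⊆ [0,1], μ(A) = 1}`. -/
def mdim (μ : Measure ℝ) : ℝ≥0∞ :=
  ⨅ (A : Set ℝ) (_ : A ⊆ Icc (0:ℝ) 1) (_ : μ A = 1), dimH A

/-- Condition (B1) (saturation). -/
def SatB1 (Φ : PIFS) (Pi : (ℕ → ℕ) → ℝ) : Prop :=
  dimH (limitSet Φ Pi) = ⨆ ν ∈ MeasClass Φ Pi, mdim (Measure.map Pi ν)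

/-- Condition (B2) (mild distortion): `D₁(Φ) < ∞` and `D_n(Φ) = o(n)`. -/
def MildB2 (Φ : PIFS) : Prop :=
  (∃ C : ℝ, ∀ i ∈ Φ.I, ∀ x ∈ Icc (0:ℝ) 1, ∀ y ∈ Icc (0:ℝ) 1,
    |deriv (Φ.φ i) x| ≤ C * |deriv (Φ.φ i) y|) ∧
  ∀ ε : ℝ, 0 < ε → ∃ N : ℕ, ∀ n, N ≤ n → ∀ l ∈ Words Φ n,
    ∀ x ∈ Icc (0:ℝ) 1, ∀ y ∈ Icc (0:ℝ) 1,
      |deriv (wcomp Φ.φ l) x| ≤ Real.exp (ε * n) * |deriv (wcomp Φ.φ l) y|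

/-- Composition along a sequence of finite words:
`φ_{σ₀} ∘ φ_{σ₁} ∘ ⋯ ∘ φ_{σ_{n-1}}`. -/
def seqComp (φ : ℕ → ℝ → ℝ) (σ : ℕ → List ℕ) : ℕ → ℝ → ℝ
  | 0 => id
  | n + 1 => seqComp φ σ n ∘ wcomp φ (σ n)

/-- The limit set of the finite IFS `{φ_w}_{w ∈ W}` indexed by words. -/
def finLimitSet (φ : ℕ → ℝ → ℝ) (W : Set (List ℕ)) : Set ℝ :=
  {x | ∃ σ : ℕ → List ℕ, (∀ k, σ k ∈ W) ∧ ∀ n, x ∈ seqComp φ σ n '' Icc (0:ℝ) 1}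

/-- `τ(x) = x / log log x`. -/
def tau (x : ℝ) : ℝ := x / Real.log (Real.log x)

/-- Number of insertion positions among `1,…,j`. -/
def cnt (nseq : ℕ → ℕ) (j : ℕ) : ℕ :=
  ((Finset.range (j + 1)).filter fun k => 1 ≤ k ∧ nseq k ≤ j).card

/-- Insertion of the digits `⌊α τ(n(k))⌋` at the positions `n(k)`, `k ≥ 1`, into the
(0-indexed) digit sequence `b`; index `m` corresponds to the (1-indexed) position `m + 1`. -/
def insertSeq (nseq : ℕ → ℕ) (α : ℝ) (b : ℕ → ℕ) : ℕ → ℕ := fun m =>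
  if ∃ k, 1 ≤ k ∧ nseq k = m + 1 then ⌊α * tau (m + 1)⌋₊
  else b (m - cnt nseq (m + 1))

/-- The digit sequence obtained by concatenating the words `σ 0, σ 1, …`, each of length `p`. -/
def flattenSeq (p : ℕ) (σ : ℕ → List ℕ) : ℕ → ℕ := fun m => (σ (m / p)).getD (m % p) 0

/-- The set `L_p(α)` of points obtained from points of `Λ(Φ_p)` by inserting the digits
`⌊α τ(n(k))⌋` at the positions `n(k)`. -/
def LpSet (Φ : PIFS) (Pi : (ℕ → ℕ) → ℝ) (W : Set (List ℕ)) (p : ℕ)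
    (nseq : ℕ → ℕ) (α : ℝ) : Set ℝ :=
  {x | ∃ σ : ℕ → List ℕ, (∀ k, σ k ∈ W) ∧ x = Pi (insertSeq nseq α (flattenSeq p σ))}

/-- The set `A_k` of admissible words `a₁ ⋯ a_{n(k+1)}` (0-indexed: `a 0 = a₁`):
each block between consecutive insertion positions is a concatenation of words of `W`,
and the digit at each insertion position `n(j+1)` is `⌊α τ(n(j+1))⌋`. -/
def Aset (Φ : PIFS) (W : Set (List ℕ)) (p : ℕ) (nseq mseq : ℕ → ℕ) (α : ℝ) (k : ℕ) :
    Set (ℕ → ℕ) :=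
  {a | (∀ i < nseq (k + 1), a i ∈ Φ.I) ∧
    ∀ j ≤ k,
      (∀ i < mseq j, ∃ w ∈ W, ∀ r < p, a (nseq j + i * p + r) = w.getD r 0) ∧
      a (nseq (j + 1) - 1) = ⌊α * tau (nseq (j + 1))⌋₊}

/-- `B_k = {n(k) + m p : m = 0,…,m(k)}`. -/
def Bset (nseq mseq : ℕ → ℕ) (p k : ℕ) : Set ℕ :=
  {n | ∃ m ≤ mseq k, n = nseq k + m * p}

/-- The composition `φ_{ā₁⋯ā_n}` along the word obtained from `a₁ ⋯ a_n` by eliminating the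
digits at the insertion positions `n(1), n(2), …` (0-indexed: index `n` ↔ position `n + 1`). -/
def elimComp (φ : ℕ → ℝ → ℝ) (nseq : ℕ → ℕ) (a : ℕ → ℕ) : ℕ → ℝ → ℝ
  | 0 => id
  | n + 1 =>
    if ∃ k, 1 ≤ k ∧ nseq k = n + 1 then elimComp φ nseq a n
    else elimComp φ nseq a n ∘ φ (a n)

/-- The minimal distance `K` between distinct fundamental intervals `J(w)`, `w ∈ W`. -/
def Kdist (Φ : PIFS) (W : Set (List ℕ)) : ℝ :=
  sInf {r | ∃ w ∈ W, ∃ w' ∈ W, w ≠ w' ∧ ∃ u ∈ Jset Φ w, ∃ v ∈ Jset Φ w', r = |u - v|}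

/-- The data of the insertion construction of Section 3 of the paper: a `d`-decaying
parabolic IFS `Φ` with address map `Pi` satisfying (B1) and (B2), `ε > 0`, an integer `p ≥ 2`
with `(k+p+1)^d + 2p + 1 < (k+p+2)^d`, a finite set `W ⊆ I^p` of words with pairwise disjoint
fundamental intervals, non-parabolic last letters, uniform contraction rate `e^{-γp}` and
limit set of dimension `> dim_H Λ(Φ) - ε`, the insertion positions `n(k)` (with the block
lengths `m(k)`), and `α ∈ (0,∞)`, the inserted digits `⌊α τ(n(k))⌋` belonging to `I`. -/
structure InsSetup (Φ : PIFS) (Pi : (ℕ → ℕ) → ℝ) where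
  d : ℝ
  hd : 1 < d
  hdec : Decaying Φ d
  hPi : IsAddressMap Φ Pi
  hPiMeas : Measurable Pi
  hB1 : SatB1 Φ Pi
  hB2 : MildB2 Φ
  ε : ℝ
  hε : 0 < ε
  p : ℕ
  hp2 : 2 ≤ p
  hpd : ∀ k : ℕ, ((k : ℝ) + p + 1) ^ d + 2 * p + 1 < ((k : ℝ) + p + 2) ^ d
  W : Finset (List ℕ)
  hWne : W.Nonempty
  hWsub : (↑W : Set (List ℕ)) ⊆ Words Φ p
  hWdisj : ∀ w ∈ W, ∀ w' ∈ W, w ≠ w' → Jset Φ w ∩ Jset Φ w' = ∅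
  hWlast : ∀ w ∈ W, ∀ h : w ≠ [], w.getLast h ∉ Φ.Par
  γ : ℝ
  hγ : 0 < γ
  hWcontr : ∀ w ∈ W, ∀ x ∈ Icc (0:ℝ) 1, |deriv (wcomp Φ.φ w) x| < Real.exp (-(γ * p))
  hWdim : dimH (limitSet Φ Pi) - ENNReal.ofReal ε < dimH (finLimitSet Φ.φ (↑W : Set (List ℕ)))
  α : ℝ
  hα : 0 < α
  nseq : ℕ → ℕ
  mseq : ℕ → ℕ
  hn0 : nseq 0 = 0
  hm2 : ∀ k, 2 ≤ mseq k
  hmlow : ∀ k : ℕ, (nseq k : ℝ) + ((mseq k : ℝ) - 1) * p ≤ ((k : ℝ) + p + 1) ^ d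
  hmhigh : ∀ k : ℕ, ((k : ℝ) + p + 1) ^ d < (nseq k : ℝ) + (mseq k : ℝ) * p
  hnrec : ∀ k, nseq (k + 1) = nseq k + mseq k * p + 1
  hins : ∀ k, 1 ≤ k → ⌊α * tau (nseq k)⌋₊ ∈ Φ.I

/-! ### Strict contraction of the generators -/

lemma exists_deriv_mul_eq_sub {f : ℝ → ℝ} (hf : Differentiable ℝ f) {x y : ℝ} (hxy : x < y) :
    ∃ c ∈ Ioo x y, f y - f x = deriv f c * (y - x) := by
  obtain ⟨c, hc, h⟩ := exists_deriv_eq_slope f hxy hf.continuous.continuousOn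
    hf.differentiableOn
  exact ⟨c, hc, by rw [h, div_mul_cancel₀ _ (sub_pos.2 hxy).ne']⟩

lemma abs_sub_lt_of_deriv_lt_on_Ioo {f : ℝ → ℝ} (hf : Differentiable ℝ f) {x y : ℝ} (hxy : x < y)
    (h : ∀ c ∈ Ioo x y, |deriv f c| < 1) : |f y - f x| < y - x := by
  obtain ⟨c, hc, e⟩ := exists_deriv_mul_eq_sub hf hxy
  rw [e, abs_mul, abs_of_pos (sub_pos.2 hxy)]
  nlinarith [h c hc, sub_pos.2 hxy]

lemma PIFS.abs_sub_lt_of_lt (Φ : PIFS) {i : ℕ} (hi : i ∈ Φ.I) {x y : ℝ}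
    (hx : x ∈ Icc (0:ℝ) 1) (hy : y ∈ Icc (0:ℝ) 1) (hxy : x < y) :
    |Φ.φ i y - Φ.φ i x| < y - x := by
  have hf : Differentiable ℝ (Φ.φ i) := (Φ.smooth i hi).differentiable one_ne_zero
  have hc : ∀ c ∈ Ioo x y, c ≠ Φ.fixpt i → |deriv (Φ.φ i) c| < 1 := fun c hc hne =>
    Φ.contracting i hi c ⟨hx.1.trans hc.1.le, hc.2.le.trans hy.2⟩ (Or.inr hne)
  by_cases hp : Φ.fixpt i ∈ Ioo x y
  · have h1 := abs_sub_lt_of_deriv_lt_on_Ioo hf hp.1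
      fun c h => hc c ⟨h.1, h.2.trans hp.2⟩ h.2.ne
    have h2 := abs_sub_lt_of_deriv_lt_on_Ioo hf hp.2
      fun c h => hc c ⟨hp.1.trans h.1, h.2⟩ h.1.ne'
    have h3 := abs_sub_le (Φ.φ i y) (Φ.φ i (Φ.fixpt i)) (Φ.φ i x)
    linarith
  · exact abs_sub_lt_of_deriv_lt_on_Ioo hf hxy fun c h => hc c h fun e => hp (e ▸ h)

lemma PIFS.abs_sub_lt (Φ : PIFS) {i : ℕ} (hi : i ∈ Φ.I) {x y : ℝ}
    (hx : x ∈ Icc (0:ℝ) 1) (hy : y ∈ Icc (0:ℝ) 1) (hxy : x ≠ y) :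
    |Φ.φ i x - Φ.φ i y| < |x - y| := by
  rcases hxy.lt_or_gt with h | h
  · rw [abs_sub_comm, abs_sub_comm x, abs_of_pos (sub_pos.2 h)]
    exact Φ.abs_sub_lt_of_lt hi hx hy h
  · rw [abs_of_pos (sub_pos.2 h)]
    exact Φ.abs_sub_lt_of_lt hi hy hx h

lemma PIFS.abs_sub_le (Φ : PIFS) {i : ℕ} (hi : i ∈ Φ.I) {x y : ℝ}
    (hx : x ∈ Icc (0:ℝ) 1) (hy : y ∈ Icc (0:ℝ) 1) :
    |Φ.φ i x - Φ.φ i y| ≤ |x - y| := by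
  rcases eq_or_ne x y with rfl | h
  · simp
  · exact (Φ.abs_sub_lt hi hx hy h).le

/-- At scale `ε` each generator decreases distances by a definite amount. -/
lemma PIFS.exists_abs_sub_le_sub (Φ : PIFS) {i : ℕ} (hi : i ∈ Φ.I) {ε : ℝ} (hε : 0 < ε) :
    ∃ η > 0, ∀ x ∈ Icc (0:ℝ) 1, ∀ y ∈ Icc (0:ℝ) 1, ε ≤ |x - y| →
      |Φ.φ i x - Φ.φ i y| ≤ |x - y| - η := by
  have hc : Continuous (Φ.φ i) := (Φ.smooth i hi).continuous
  set K : Set (ℝ × ℝ) := (Icc (0:ℝ) 1 ×ˢ Icc (0:ℝ) 1) ∩ {p | ε ≤ |p.1 - p.2|} with hK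
  have hKc : IsCompact K := (isCompact_Icc.prod isCompact_Icc).inter_right
    (isClosed_le continuous_const (by fun_prop))
  rcases K.eq_empty_or_nonempty with h0 | h0
  · refine ⟨1, one_pos, fun x hx y hy h => ?_⟩
    have : (x, y) ∈ K := ⟨⟨hx, hy⟩, h⟩
    simp [h0] at this
  · obtain ⟨p, hp, hmin⟩ := hKc.exists_isMinOn h0
      (f := fun p => |p.1 - p.2| - |Φ.φ i p.1 - Φ.φ i p.2|) (by fun_prop)
    refine ⟨|p.1 - p.2| - |Φ.φ i p.1 - Φ.φ i p.2|, ?_, fun x hx y hy h => ?_⟩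
    · refine sub_pos.2 (Φ.abs_sub_lt hi hp.1.1 hp.1.2 fun e => ?_)
      have := hp.2
      simp [e] at this
      linarith
    · have := hmin (show (x, y) ∈ K from ⟨⟨hx, hy⟩, h⟩)
      simp only [mem_ofPred_eq] at this
      linarith

lemma PIFS.eventually_iterate_abs_sub_lt (Φ : PIFS) {i : ℕ} (hi : i ∈ Φ.I) {ε : ℝ}
    (hε : 0 < ε) :
    ∀ᶠ n : ℕ in atTop, ∀ x ∈ Icc (0:ℝ) 1, ∀ y ∈ Icc (0:ℝ) 1,
      |(Φ.φ i)^[n] x - (Φ.φ i)^[n] y| < ε := by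
  obtain ⟨η, hη, h⟩ := Φ.exists_abs_sub_le_sub hi hε
  obtain ⟨N, hN⟩ := exists_nat_gt (1 / η)
  rw [div_lt_iff₀ hη] at hN
  refine eventually_atTop.2 ⟨N, fun n hn x hx y hy => ?_⟩
  have key : ∀ n : ℕ, ε ≤ |(Φ.φ i)^[n] x - (Φ.φ i)^[n] y| →
      |(Φ.φ i)^[n] x - (Φ.φ i)^[n] y| ≤ 1 - n * η := by
    intro n
    induction n with
    | zero => intro _; simpa using abs_sub_le_of_le_of_le hx.1 hx.2 hy.1 hy.2
    | succ n ih =>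
      rw [Function.iterate_succ_apply', Function.iterate_succ_apply']
      intro he
      have hx' := (Φ.maps_to i hi).iterate n hx
      have hy' := (Φ.maps_to i hi).iterate n hy
      have he' := he.trans (Φ.abs_sub_le hi hx' hy')
      have := h _ hx' _ hy' he'
      have := ih he'
      push_cast
      linarith
  by_contra! hcon
  have h1 := key n hcon
  have h2 : (N : ℝ) * η ≤ n * η := by gcongr
  linarith

/-- Each generator has image of diameter less than one. -/
lemma PIFS.eventually_abs_sub_le_one_sub (Φ : PIFS) {i : ℕ} (hi : i ∈ Φ.I) :
    ∀ᶠ δ : ℝ in 𝓝[>] 0, ∀ x ∈ Icc (0:ℝ) 1, ∀ y ∈ Icc (0:ℝ) 1,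
      |Φ.φ i x - Φ.φ i y| ≤ 1 - δ := by
  obtain ⟨η, hη, h⟩ := Φ.exists_abs_sub_le_sub hi (ε := 1 / 2) (by norm_num)
  filter_upwards [Ioo_mem_nhdsGT (lt_min hη (by norm_num : (0:ℝ) < 1 / 2))] with δ hδ x hx y hy
  have h1 : δ < η := hδ.2.trans_le (min_le_left _ _)
  have h2 : δ < 1 / 2 := hδ.2.trans_le (min_le_right _ _)
  have h3 : |x - y| ≤ 1 := by simpa using abs_sub_le_of_le_of_le hx.1 hx.2 hy.1 hy.2
  rcases le_total (1 / 2) |x - y| with hxy | hxy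
  · linarith [h x hx y hy hxy]
  · linarith [Φ.abs_sub_le hi hx hy]

/-- By the open set condition, only finitely many generators have image of diameter at
least `ε`. -/
lemma PIFS.finite_large_letters (Φ : PIFS) {ε : ℝ} (hε : 0 < ε) :
    {i | i ∈ Φ.I ∧ ∃ x ∈ Icc (0:ℝ) 1, ∃ y ∈ Icc (0:ℝ) 1,
      ε ≤ |Φ.φ i x - Φ.φ i y|}.Finite := by
  have hc : ∀ i : Φ.I, Continuous (Φ.φ i) := fun i => (Φ.smooth i i.2).continuous
  have hfin := Measure.finite_const_le_meas_of_disjoint_iUnion (volume : Measure ℝ)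
    (ε := ENNReal.ofReal ε) (by simpa using hε) (As := fun i : Φ.I => Φ.φ i '' Ioo (0:ℝ) 1)
    (fun i => (isPreconnected_Ioo.image _ (hc i).continuousOn).ordConnected.measurableSet)
    (fun i j hij => disjoint_iff_inter_eq_empty.2
      (Φ.osc i i.2 j j.2 fun e => hij (Subtype.ext e)))
    (ne_top_of_le_ne_top (b := volume (Icc (0:ℝ) 1)) (by simp)
      (measure_mono (iUnion_subset fun i =>
        ((Φ.maps_to i i.2).mono_left Ioo_subset_Icc_self).image_subset)))
  refine (hfin.image Subtype.val).subset ?_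
  rintro i ⟨hi, x, hx, y, hy, hxy⟩
  refine ⟨⟨i, hi⟩, ?_, rfl⟩
  have hvol : ∀ u ∈ Icc (0:ℝ) 1, ∀ v ∈ Icc (0:ℝ) 1, u ≤ v → ε ≤ |Φ.φ i u - Φ.φ i v| →
      ENNReal.ofReal ε ≤ volume (Φ.φ i '' Ioo (0:ℝ) 1) := by
    intro u hu v hv huv he
    have hsub : Φ.φ i '' Ioo u v ⊆ Φ.φ i '' Ioo (0:ℝ) 1 :=
      image_mono (Ioo_subset_Ioo hu.1 hv.2)
    have hci := (hc ⟨i, hi⟩).continuousOn (s := Icc u v)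
    rcases le_total (Φ.φ i u) (Φ.φ i v) with h | h
    · rw [abs_sub_comm, abs_of_nonneg (sub_nonneg.2 h)] at he
      refine le_trans ?_ (measure_mono ((intermediate_value_Ioo huv hci).trans hsub))
      rw [Real.volume_Ioo]
      exact ENNReal.ofReal_le_ofReal he
    · rw [abs_of_nonneg (sub_nonneg.2 h)] at he
      refine le_trans ?_ (measure_mono ((intermediate_value_Ioo' huv hci).trans hsub))
      rw [Real.volume_Ioo]
      exact ENNReal.ofReal_le_ofReal he
  rcases le_total x y with h | h
  · exact hvol x hx y hy h hxy
  · exact hvol y hy x hx h (by rwa [abs_sub_comm])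

/-! ### Bounded distortion -/

/-- Under bounded distortion `C`, a subinterval of `[0,1]` of length at most `1 - δ` has image of
relative length at most `1 - δ / C`. -/
lemma sub_le_of_deriv_le_mul_deriv {f : ℝ → ℝ} (hf : Differentiable ℝ f) {C δ : ℝ} (hC : 0 < C)
    (h0 : ∀ x ∈ Icc (0:ℝ) 1, 0 ≤ deriv f x)
    (hd : ∀ x ∈ Icc (0:ℝ) 1, ∀ y ∈ Icc (0:ℝ) 1, deriv f x ≤ C * deriv f y)
    {a b : ℝ} (ha : a ∈ Icc (0:ℝ) 1) (hb : b ∈ Icc (0:ℝ) 1) (hab : |a - b| ≤ 1 - δ) :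
    |f a - f b| ≤ (1 - δ / C) * |f 1 - f 0| := by
  wlog hle : a ≤ b generalizing a b
  · rw [abs_sub_comm]
    exact this hb ha (by rwa [abs_sub_comm]) (le_of_not_ge hle)
  obtain ⟨c, hc, e⟩ := exists_deriv_mul_eq_sub hf (zero_lt_one' ℝ)
  have hc' := Ioo_subset_Icc_self hc
  simp only [sub_zero, mul_one] at e
  have hlow : ∀ u ∈ Icc (0:ℝ) 1, ∀ v ∈ Icc (0:ℝ) 1, u ≤ v →
      (f 1 - f 0) / C * (v - u) ≤ f v - f u := by
    intro u hu v hv huv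
    rcases huv.eq_or_lt with rfl | huv
    · simp
    obtain ⟨w, hw, ew⟩ := exists_deriv_mul_eq_sub hf huv
    rw [ew, e]
    refine mul_le_mul_of_nonneg_right ?_ (sub_pos.2 huv).le
    rw [div_le_iff₀ hC, mul_comm]
    exact hd c hc' w ⟨hu.1.trans hw.1.le, hw.2.le.trans hv.2⟩
  have hpos : 0 ≤ f 1 - f 0 := e ▸ h0 c hc'
  have h1 := hlow 0 (by simp) a ha ha.1
  have h2 := hlow b hb 1 (by simp) hb.2
  have h3 := hlow a ha b hb hle
  have h4 : 0 ≤ (f 1 - f 0) / C * (b - a) :=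
    mul_nonneg (div_nonneg hpos hC.le) (sub_nonneg.2 hle)
  rw [abs_sub_comm, abs_of_nonneg (sub_nonneg.2 hle)] at hab
  rw [abs_sub_comm, abs_of_nonneg (h4.trans h3), abs_of_nonneg hpos]
  have h5 : (f 1 - f 0) / C * δ ≤ (f 1 - f 0) / C * (1 - (b - a)) := by
    gcongr
    linarith
  have h6 : (1 - δ / C) * (f 1 - f 0) = (f 1 - f 0) - (f 1 - f 0) / C * δ := by ring
  linarith

lemma abs_sub_le_of_abs_deriv_le_mul {f : ℝ → ℝ} (hf : Differentiable ℝ f) {C δ : ℝ} (hC : 0 < C)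
    (hd : ∀ x ∈ Icc (0:ℝ) 1, ∀ y ∈ Icc (0:ℝ) 1, |deriv f x| ≤ C * |deriv f y|)
    {a b : ℝ} (ha : a ∈ Icc (0:ℝ) 1) (hb : b ∈ Icc (0:ℝ) 1) (hab : |a - b| ≤ 1 - δ) :
    |f a - f b| ≤ (1 - δ / C) * |f 1 - f 0| := by
  have hsign : (∀ x ∈ Icc (0:ℝ) 1, 0 ≤ deriv f x) ∨ ∀ x ∈ Icc (0:ℝ) 1, deriv f x ≤ 0 := by
    by_cases hz : ∃ y ∈ Icc (0:ℝ) 1, deriv f y = 0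
    · obtain ⟨y, hy, hy0⟩ := hz
      left
      intro x hx
      have := hd x hx y hy
      rw [hy0, abs_zero, mul_zero] at this
      exact (abs_eq_zero.1 (le_antisymm this (abs_nonneg _))).ge
    · push Not at hz
      rcases hasDerivWithinAt_forall_lt_or_forall_gt_of_forall_ne (convex_Icc (0:ℝ) 1)
        (fun x _ => (hf x).hasDerivAt.hasDerivWithinAt) hz with h | h
      · exact Or.inr fun x hx => (h x hx).le
      · exact Or.inl fun x hx => (h x hx).le
  rcases hsign with h | h
  · refine sub_le_of_deriv_le_mul_deriv hf hC h (fun x hx y hy => ?_) ha hb hab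
    simpa only [abs_of_nonneg (h x hx), abs_of_nonneg (h y hy)] using hd x hx y hy
  · have hn : ∀ x, deriv (-f) x = -deriv f x := fun x => deriv.neg
    have := sub_le_of_deriv_le_mul_deriv hf.neg hC (fun x hx => ?_) (fun x hx y hy => ?_) ha hb hab
    · simpa only [Pi.neg_apply, neg_sub_neg, abs_sub_comm (f b), abs_sub_comm (f 0)] using this
    · rw [hn]
      exact neg_nonneg.2 (h x hx)
    · rw [hn, hn]
      simpa only [abs_of_nonpos (h x hx), abs_of_nonpos (h y hy)] using hd x hx y hy

/-! ### Compositions along digit sequences -/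

lemma comp_add (φ : ℕ → ℝ → ℝ) (ω : ℕ → ℕ) (m n : ℕ) (x : ℝ) :
    comp φ ω (m + n) x = comp φ ω m (comp φ (fun j => ω (m + j)) n x) := by
  induction n generalizing x with
  | zero => rfl
  | succ n ih => exact ih _

lemma comp_eq_iterate (φ : ℕ → ℝ → ℝ) (ω : ℕ → ℕ) (i n : ℕ) (h : ∀ j < n, ω j = i) :
    comp φ ω n = (φ i)^[n] := by
  induction n with
  | zero => rfl
  | succ n ih =>
    rw [comp, ih fun j hj => h j (hj.trans n.lt_succ_self), h n n.lt_succ_self,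
      Function.iterate_succ]

lemma comp_getD (φ : ℕ → ℝ → ℝ) (l : List ℕ) (a : ℕ) :
    comp φ (fun k => l.getD k a) l.length = wcomp φ l := by
  induction l with
  | nil => rfl
  | cons b l ih =>
    funext x
    rw [List.length_cons, add_comm, comp_add]
    simp only [Nat.add_comm 1, List.getD_cons_succ, ih]
    simp [comp, wcomp]

lemma PIFS.comp_mapsTo (Φ : PIFS) {ω : ℕ → ℕ} (hω : ∀ k, ω k ∈ Φ.I) (n : ℕ) :
    MapsTo (comp Φ.φ ω n) (Icc (0:ℝ) 1) (Icc (0:ℝ) 1) := by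
  induction n with
  | zero => exact mapsTo_id _
  | succ n ih => exact ih.comp (Φ.maps_to _ (hω n))

lemma PIFS.comp_differentiable (Φ : PIFS) {ω : ℕ → ℕ} (hω : ∀ k, ω k ∈ Φ.I) (n : ℕ) :
    Differentiable ℝ (comp Φ.φ ω n) := by
  induction n with
  | zero => exact differentiable_id
  | succ n ih => exact ih.comp ((Φ.smooth _ (hω n)).differentiable one_ne_zero)

lemma PIFS.comp_abs_sub_le (Φ : PIFS) {ω : ℕ → ℕ} (hω : ∀ k, ω k ∈ Φ.I) (n : ℕ) {x y : ℝ}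
    (hx : x ∈ Icc (0:ℝ) 1) (hy : y ∈ Icc (0:ℝ) 1) :
    |comp Φ.φ ω n x - comp Φ.φ ω n y| ≤ |x - y| := by
  induction n generalizing x y with
  | zero => exact le_rfl
  | succ n ih =>
    exact (ih (Φ.maps_to _ (hω n) hx) (Φ.maps_to _ (hω n) hy)).trans (Φ.abs_sub_le (hω n) hx hy)

/-- A bound on the diameter of a factor bounds the diameter of the whole word. -/
lemma PIFS.comp_abs_sub_lt_of_factor (Φ : PIFS) {ω : ℕ → ℕ} (hω : ∀ k, ω k ∈ Φ.I)
    {m k n : ℕ} (hmk : m + k ≤ n) {ε : ℝ}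
    (h : ∀ x ∈ Icc (0:ℝ) 1, ∀ y ∈ Icc (0:ℝ) 1,
      |comp Φ.φ (fun j => ω (m + j)) k x - comp Φ.φ (fun j => ω (m + j)) k y| < ε)
    {x y : ℝ} (hx : x ∈ Icc (0:ℝ) 1) (hy : y ∈ Icc (0:ℝ) 1) :
    |comp Φ.φ ω n x - comp Φ.φ ω n y| < ε := by
  obtain ⟨r, rfl⟩ := Nat.exists_eq_add_of_le hmk
  simp only [comp_add]
  have hr := Φ.comp_mapsTo (ω := fun j => ω (m + k + j)) (fun j => hω _) r
  have hk := Φ.comp_mapsTo (ω := fun j => ω (m + j)) (fun j => hω _) k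
  exact (Φ.comp_abs_sub_le hω m (hk (hr hx)) (hk (hr hy))).trans_lt (h _ (hr hx) _ (hr hy))

lemma PIFS.comp_abs_sub_le_of_le (Φ : PIFS) {ω : ℕ → ℕ} (hω : ∀ k, ω k ∈ Φ.I)
    {m n : ℕ} (hmn : m ≤ n) {R : ℝ}
    (h : ∀ x ∈ Icc (0:ℝ) 1, ∀ y ∈ Icc (0:ℝ) 1, |comp Φ.φ ω m x - comp Φ.φ ω m y| ≤ R)
    {x y : ℝ} (hx : x ∈ Icc (0:ℝ) 1) (hy : y ∈ Icc (0:ℝ) 1) :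
    |comp Φ.φ ω n x - comp Φ.φ ω n y| ≤ R := by
  obtain ⟨r, rfl⟩ := Nat.exists_eq_add_of_le hmn
  rw [comp_add, comp_add]
  have hr := Φ.comp_mapsTo (ω := fun j => ω (m + j)) (fun j => hω _) r
  exact h _ (hr hx) _ (hr hy)

/-- If position `m + 1` does not end a run of a parabolic letter, then appending a letter with image
of diameter at most `1 - δ` contracts by the factor `1 - δ / distC`. -/
lemma PIFS.comp_succ_abs_sub_le (Φ : PIFS) {ω : ℕ → ℕ} (hω : ∀ k, ω k ∈ Φ.I) {m : ℕ}
    (hgood : ω (m + 1) ∉ Φ.Par ∨ ω m ≠ ω (m + 1)) {δ R : ℝ} (hδ : δ ≤ 1)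
    (hlet : ∀ x ∈ Icc (0:ℝ) 1, ∀ y ∈ Icc (0:ℝ) 1,
      |Φ.φ (ω (m + 2)) x - Φ.φ (ω (m + 2)) y| ≤ 1 - δ)
    (h : ∀ x ∈ Icc (0:ℝ) 1, ∀ y ∈ Icc (0:ℝ) 1,
      |comp Φ.φ ω (m + 2) x - comp Φ.φ ω (m + 2) y| ≤ R)
    {x y : ℝ} (hx : x ∈ Icc (0:ℝ) 1) (hy : y ∈ Icc (0:ℝ) 1) :
    |comp Φ.φ ω (m + 3) x - comp Φ.φ ω (m + 3) y| ≤ (1 - δ / Φ.distC) * R := by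
  have hC : 0 < Φ.distC := one_pos.trans_le Φ.distC_ge_one
  have hmap := Φ.maps_to _ (hω (m + 2))
  refine (abs_sub_le_of_abs_deriv_le_mul (Φ.comp_differentiable hω (m + 2)) hC
    (Φ.distortion ω hω (m + 2) (by omega) hgood) (hmap hx) (hmap hy) (hlet x hx y hy)).trans ?_
  have hq : 0 ≤ 1 - δ / Φ.distC := by
    rw [sub_nonneg, div_le_one hC]
    exact hδ.trans Φ.distC_ge_one
  exact mul_le_mul_of_nonneg_left (h 1 (by simp) 0 (by simp)) hq

/-- Uniform decay along digit sequences. -/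
lemma PIFS.eventually_comp_abs_sub_lt (Φ : PIFS) {ε : ℝ} (hε : 0 < ε) :
    ∀ᶠ n : ℕ in atTop, ∀ ω : ℕ → ℕ, (∀ k, ω k ∈ Φ.I) →
      ∀ x ∈ Icc (0:ℝ) 1, ∀ y ∈ Icc (0:ℝ) 1, |comp Φ.φ ω n x - comp Φ.φ ω n y| < ε := by
  set F := {i | i ∈ Φ.I ∧ ∃ x ∈ Icc (0:ℝ) 1, ∃ y ∈ Icc (0:ℝ) 1, ε ≤ |Φ.φ i x - Φ.φ i y|}
    with hF
  obtain ⟨k, hk⟩ := ((eventually_all_finite Φ.Par_finite).2 fun i hi =>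
    Φ.eventually_iterate_abs_sub_lt (Φ.Par_sub hi) hε).exists
  obtain ⟨δ, hδF, hδ0, hδ1⟩ := (((eventually_all_finite (Φ.finite_large_letters hε)).2
    fun i hi => Φ.eventually_abs_sub_le_one_sub hi.1).and
      (Ioo_mem_nhdsGT (zero_lt_one' ℝ))).exists
  have hC : 0 < Φ.distC := one_pos.trans_le Φ.distC_ge_one
  obtain ⟨t, ht⟩ := exists_pow_lt_of_lt_one hε (sub_lt_self 1 (div_pos hδ0 hC))
  refine eventually_atTop.2 ⟨(k + 3) * t, fun n hn ω hω x hx y hy => ?_⟩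
  by_cases hlarge : ∃ j < n, ω j ∉ F
  · obtain ⟨j, hj, hjF⟩ := hlarge
    refine Φ.comp_abs_sub_lt_of_factor hω (m := j) (k := 1) hj (fun u hu v hv => ?_) hx hy
    by_contra! hcon
    exact hjF ⟨hω j, u, hu, v, hv, hcon⟩
  by_cases hrun : ∃ m, m + k ≤ n ∧ ∃ i ∈ Φ.Par, ∀ j < k, ω (m + j) = i
  · obtain ⟨m, hm, i, hi, hj⟩ := hrun
    refine Φ.comp_abs_sub_lt_of_factor hω hm ?_ hx hy
    rw [comp_eq_iterate _ _ i k hj]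
    exact hk i hi
  push Not at hlarge hrun
  have hblock : ∀ s : ℕ, (k + 3) * s ≤ n → ∀ x ∈ Icc (0:ℝ) 1, ∀ y ∈ Icc (0:ℝ) 1,
      |comp Φ.φ ω ((k + 3) * s) x - comp Φ.φ ω ((k + 3) * s) y| ≤ (1 - δ / Φ.distC) ^ s := by
    intro s
    induction s with
    | zero =>
      intro _ u hu v hv
      simpa [comp] using abs_sub_le_of_le_of_le hu.1 hu.2 hv.1 hv.2
    | succ s ih =>
      intro hs u hu v hv
      rw [mul_add, mul_one] at hs ⊢
      set m := (k + 3) * s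
      obtain ⟨j, hjk, hgood⟩ : ∃ j ≤ k, ω (m + j + 1) ∉ Φ.Par ∨ ω (m + j) ≠ ω (m + j + 1) := by
        by_contra! hcon
        have hconst : ∀ j < k, ω (m + j) = ω (m + 1) := by
          intro j
          induction j with
          | zero => exact fun _ => (hcon 0 k.zero_le).2
          | succ j ihj => exact fun hj => (hcon j (by omega)).2.symm.trans (ihj (by omega))
        obtain ⟨j, hj, hne⟩ := hrun m (by omega) (ω (m + 1)) (hcon 0 k.zero_le).1
        exact hne (hconst j hj)
      rw [pow_succ']
      refine Φ.comp_abs_sub_le_of_le hω (m := m + j + 3) (by omega) (fun u hu v hv => ?_) hu hv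
      refine Φ.comp_succ_abs_sub_le hω hgood hδ1.le (hδF _ (hlarge _ (by omega)))
        (fun u hu v hv => ?_) hu hv
      exact Φ.comp_abs_sub_le_of_le hω (m := m) (by omega) (ih (by omega)) hu hv
  exact (Φ.comp_abs_sub_le_of_le hω hn (hblock t hn) hx hy).trans_lt ht

/-- **Lemma.** A parabolic IFS with `D₁(Φ) < ∞` has uniform decay of fundamental
intervals: `sup_{ω ∈ I^n} |J(ω)| → 0` as `n → ∞`. -/
theorem uniform_decay_of_fundamental_intervals (Φ : PIFS)
    (hD1 : ∃ C : ℝ, ∀ i ∈ Φ.I, ∀ x ∈ Icc (0:ℝ) 1, ∀ y ∈ Icc (0:ℝ) 1,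
      |deriv (Φ.φ i) x| ≤ C * |deriv (Φ.φ i) y|) :
    Tendsto (fun n : ℕ => ⨆ l ∈ Words Φ n, EMetric.diam (Jset Φ l)) atTop (𝓝 0) := by
  obtain ⟨a, ha⟩ := Φ.I_nontrivial.nonempty
  refine ENNReal.tendsto_nhds_zero.2 fun e he => ?_
  obtain ⟨ε, hε, hεe⟩ : ∃ ε : ℝ, 0 < ε ∧ ENNReal.ofReal ε ≤ e := by
    obtain ⟨r, hr0, hre⟩ := ENNReal.lt_iff_exists_nnreal_btwn.1 he
    exact ⟨r, by exact_mod_cast hr0, by simpa using hre.le⟩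
  filter_upwards [Φ.eventually_comp_abs_sub_lt hε] with n hn
  refine iSup₂_le fun l hl => le_trans (Metric.ediam_le ?_) hεe
  rintro _ ⟨x, hx, rfl⟩ _ ⟨y, hy, rfl⟩
  rw [edist_dist, Real.dist_eq, ← comp_getD Φ.φ l a, hl.1]
  refine ENNReal.ofReal_le_ofReal (hn _ (fun k => ?_) x hx y hy).le
  rcases lt_or_ge k l.length with hk | hk
  · rw [List.getD_eq_getElem _ _ hk]
    exact hl.2 _ (List.getElem_mem hk)
  · rw [List.getD_eq_default _ _ hk]
    exact ha

end

end ParabolicIFSPaper
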